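/- arXiv:1406.5378 — 3 statements merged into one kernel-verified Lean document; each statement's English description precedes it below -/
import Mathlib

section
/- The locally convergent series form a subgroup of the output feedback group: if c, d ∈ ℝ^m⟨⟨X⟩⟩ are locally convergent, then so are c ⊚ d := d + c ∘̃ d and the composition inverse c^{-1} (the unique series with c^{-1} = (−c) ∘̃ c^{-1}). Hence (ℝ^m_{LC}⟨⟨X⟩⟩, ⊚) with identity 0 is a subgroup of (ℝ^m⟨⟨X⟩⟩, ⊚). -/
open scoped BigOperators

/-- A word over the alphabet `X = {x_0, x_1, …, x_m}`. -/
abbrev Word (m : ℕ) := List (Fin (m+1))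

/-- A formal power series in `ℝ⟨⟨X⟩⟩`. -/
abbrev Series (m : ℕ) := Word m → ℝ

/-- A formal power series in `ℝ^l⟨⟨X⟩⟩`. -/
abbrev SeriesVec (l m : ℕ) := Fin l → Series m

/-- The shuffle product on `ℝ⟨⟨X⟩⟩`, defined via the coefficient recursion
`(c ⧢ d, x_i η) = (c^{x_i} ⧢ d, η) + (c ⧢ d^{x_i}, η)` which is the bilinear
extension of `(x_i η) ⧢ (x_j ξ) = x_i (η ⧢ (x_j ξ)) + x_j ((x_i η) ⧢ ξ)`. -/
def shuffle {m : ℕ} : Series m → Series m → Series m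
  | c, d, [] => c [] * d []
  | c, d, i :: η => shuffle (fun w => c (i :: w)) d η + shuffle c (fun w => d (i :: w)) η

/-- `x_ℓ c` : prepend the letter `x_ℓ` to every word of `c`. -/
def prepend {m : ℕ} (ℓ : Fin (m+1)) (c : Series m) : Series m
  | [] => 0
  | j :: w => if j = ℓ then c w else 0

/-- The left quotient `c^{x_ℓ}` : `(c^{x_ℓ}, η) = (c, x_ℓ η)`. -/
def leftQuot {m : ℕ} (ℓ : Fin (m+1)) (c : Series m) : Series m :=
  fun w => c (ℓ :: w)

/-- The series `1∅`. -/
def oneSeries {m : ℕ} : Series m := fun w => if w = [] then 1 else 0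

/-- The constant series `K∅`. -/
def constSeries {m : ℕ} (K : ℝ) : Series m := fun w => if w = [] then K else 0

/-- The component `d_ℓ` of `d ∈ ℝ^m⟨⟨X⟩⟩` indexed by letters, with `d_0 := 0`. -/
def dhat {m : ℕ} (d : Fin m → Series m) (ℓ : Fin (m+1)) : Series m :=
  Fin.cases (motive := fun _ => Series m) 0 d ℓ

/-- The component `d_ℓ` of `d ∈ ℝ^m⟨⟨X⟩⟩` indexed by letters, with `d_0 := 1`. -/
def dtil {m : ℕ} (d : Fin m → Series m) (ℓ : Fin (m+1)) : Series m :=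
  Fin.cases (motive := fun _ => Series m) oneSeries d ℓ

/-- `φ_d(x_ℓ)(e) = x_ℓ e + x_0 (d_ℓ ⧢ e)` with `d_0 := 0`. -/
def phiLetter {m : ℕ} (d : Fin m → Series m) (ℓ : Fin (m+1)) (e : Series m) : Series m :=
  prepend ℓ e + prepend 0 (shuffle (dhat d ℓ) e)

/-- `φ_d(η)` for a word `η`, with `φ_d(∅) = id` and `φ_d(x_ℓ η) = φ_d(x_ℓ) ∘ φ_d(η)`. -/
def phi {m : ℕ} (d : Fin m → Series m) : Word m → Series m → Series m
  | [], e => e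
  | ℓ :: η, e => phiLetter d ℓ (phi d η e)

/-- The modified composition product `c ∘̃ d = Σ_{η ∈ X*} (c, η) φ_d(η)(1)`.
Since `φ_d(η)(1)` has no words of length `< |η|`, the coefficient of a word `ν`
is given by the (finite) sum over all words `η` with `|η| ≤ |ν|`. -/
def modComp {m : ℕ} (c : Series m) (d : Fin m → Series m) : Series m :=
  fun ν => ∑ k ∈ Finset.range (ν.length + 1), ∑ η : Fin k → Fin (m+1),
    c (List.ofFn η) * phi d (List.ofFn η) oneSeries ν

/-- The modified composition product on `ℝ^l⟨⟨X⟩⟩`, componentwise. -/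
def modCompVec {l m : ℕ} (c : SeriesVec l m) (d : SeriesVec m m) : SeriesVec l m :=
  fun i => modComp (c i) d

/-- `ψ_d(x_ℓ)(e) = x_0 (d_ℓ ⧢ e)` with `d_0 := 1`. -/
def psiLetter {m : ℕ} (d : Fin m → Series m) (ℓ : Fin (m+1)) (e : Series m) : Series m :=
  prepend 0 (shuffle (dtil d ℓ) e)

/-- `ψ_d(η)` for a word `η`, with `ψ_d(∅) = id` and `ψ_d(x_ℓ η) = ψ_d(x_ℓ) ∘ ψ_d(η)`. -/
def psi {m : ℕ} (d : Fin m → Series m) : Word m → Series m → Series m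
  | [], e => e
  | ℓ :: η, e => psiLetter d ℓ (psi d η e)

/-- The composition product `c ∘ d = Σ_{η ∈ X*} (c, η) ψ_d(η)(1)`. -/
def comp {m : ℕ} (c : Series m) (d : Fin m → Series m) : Series m :=
  fun ν => ∑ k ∈ Finset.range (ν.length + 1), ∑ η : Fin k → Fin (m+1),
    c (List.ofFn η) * psi d (List.ofFn η) oneSeries ν

/-- The composition product on `ℝ^l⟨⟨X⟩⟩`, componentwise. -/
def compVec {l m : ℕ} (c : SeriesVec l m) (d : SeriesVec m m) : SeriesVec l m :=
  fun i => comp (c i) d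

/-- The group product `c ⊚ d := d + c ∘̃ d` of the output feedback group,
so that `(δ + c) ∘ (δ + d) = δ + c ⊚ d`. -/
def oplus {m : ℕ} (c d : SeriesVec m m) : SeriesVec m m :=
  d + modCompVec c d

/-- A series `c ∈ ℝ^m⟨⟨X⟩⟩` is locally convergent if
`|(c, η)| ≤ K M^{|η|} |η|!` for all `η ∈ X*` and some `K, M > 0`. -/
def IsLocallyConvergent {m : ℕ} (c : SeriesVec m m) : Prop :=
  ∃ K M : ℝ, 0 < K ∧ 0 < M ∧
    ∀ (η : Word m) (i : Fin m), |c i η| ≤ K * M ^ η.length * (Nat.factorial η.length : ℝ)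


open PowerSeries in
/-- The scalar power series `f` dominates the noncommutative series `c`:
`|(c, η)| ≤ |η|! f_{|η|}` for every word `η`. -/
def Majorizes {m : ℕ} (f : PowerSeries ℝ) (c : Series m) : Prop :=
  ∀ η : Word m, |c η| ≤ (Nat.factorial η.length : ℝ) * coeff η.length f

/-- The partial sum `∑_{i < n} f_i ρ^i`. -/
noncomputable def partialEval (ρ : ℝ) (n : ℕ) (f : PowerSeries ℝ) : ℝ :=
  ∑ i ∈ Finset.range n, PowerSeries.coeff i f * ρ ^ i

section PowerSeriesBounds

open PowerSeries

lemma coeff_mul_nonneg {f g : PowerSeries ℝ} (hf : ∀ n, 0 ≤ coeff n f)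
    (hg : ∀ n, 0 ≤ coeff n g) (n : ℕ) : 0 ≤ coeff n (f * g) := by
  rw [coeff_mul]
  exact Finset.sum_nonneg fun p _ => mul_nonneg (hf _) (hg _)

lemma coeff_pow_nonneg {f : PowerSeries ℝ} (hf : ∀ n, 0 ≤ coeff n f) (k n : ℕ) :
    0 ≤ coeff n (f ^ k) := by
  induction k generalizing n with
  | zero => rw [pow_zero, coeff_one]; split_ifs <;> norm_num
  | succ k ih => rw [pow_succ]; exact coeff_mul_nonneg ih hf n

lemma coeff_mul_le_coeff_mul {f g h : PowerSeries ℝ} (hf : ∀ n, 0 ≤ coeff n f)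
    (hgh : ∀ n, coeff n g ≤ coeff n h) (n : ℕ) : coeff n (f * g) ≤ coeff n (f * h) := by
  rw [coeff_mul, coeff_mul]
  exact Finset.sum_le_sum fun p _ => mul_le_mul_of_nonneg_left (hgh _) (hf _)

lemma partialEval_nonneg {ρ : ℝ} (hρ : 0 ≤ ρ) {f : PowerSeries ℝ} (hf : ∀ n, 0 ≤ coeff n f)
    (n : ℕ) : 0 ≤ partialEval ρ n f :=
  Finset.sum_nonneg fun i _ => mul_nonneg (hf i) (pow_nonneg hρ i)

lemma coeff_mul_pow_le_partialEval {ρ : ℝ} (hρ : 0 ≤ ρ) {f : PowerSeries ℝ}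
    (hf : ∀ n, 0 ≤ coeff n f) (n : ℕ) : coeff n f * ρ ^ n ≤ partialEval ρ (n + 1) f :=
  Finset.single_le_sum (f := fun i => coeff i f * ρ ^ i)
    (fun i _ => mul_nonneg (hf i) (pow_nonneg hρ i)) (Finset.self_mem_range_succ n)

lemma partialEval_mul_le {ρ : ℝ} (hρ : 0 ≤ ρ) {f g : PowerSeries ℝ}
    (hf : ∀ n, 0 ≤ coeff n f) (hg : ∀ n, 0 ≤ coeff n g) (n : ℕ) :
    partialEval ρ n (f * g) ≤ partialEval ρ n f * partialEval ρ n g := by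
  unfold partialEval
  rw [Finset.sum_mul_sum, ← Finset.sum_product']
  simp_rw [coeff_mul, Finset.sum_mul]
  rw [Finset.sum_sigma']
  have key : ∀ x ∈ (Finset.range n).sigma fun i => Finset.HasAntidiagonal.antidiagonal i,
      x.2.1 + x.2.2 = x.1 ∧ x.1 < n := by
    rintro ⟨i, p⟩ hx
    simp only [Finset.mem_sigma, Finset.mem_range, Finset.HasAntidiagonal.mem_antidiagonal] at hx
    exact ⟨hx.2, hx.1⟩
  calc _ = ∑ x ∈ (Finset.range n).sigma fun i => Finset.HasAntidiagonal.antidiagonal i,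
          (coeff x.2.1 f * ρ ^ x.2.1) * (coeff x.2.2 g * ρ ^ x.2.2) := by
        refine Finset.sum_congr rfl fun x hx => ?_
        rw [← (key x hx).1, pow_add]; ring
    _ = ∑ p ∈ ((Finset.range n).sigma fun i => Finset.HasAntidiagonal.antidiagonal i).image Sigma.snd,
          (coeff p.1 f * ρ ^ p.1) * (coeff p.2 g * ρ ^ p.2) := by
        rw [Finset.sum_image]
        rintro ⟨i, p⟩ hx ⟨j, q⟩ hy (rfl : p = q)
        have h1 := (key _ hx).1
        have h2 := (key _ hy).1
        simp only at h1 h2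
        subst h1; subst h2; rfl
    _ ≤ _ := by
        refine Finset.sum_le_sum_of_subset_of_nonneg ?_ fun p _ _ => by
          have := hf p.1; have := hg p.2; positivity
        intro p hp
        obtain ⟨x, hx, rfl⟩ := Finset.mem_image.1 hp
        have := key x hx
        simp only [Finset.mem_product, Finset.mem_range]
        omega

lemma partialEval_one_le (ρ : ℝ) (n : ℕ) : partialEval ρ n 1 ≤ 1 := by
  cases n with
  | zero => simp [partialEval]
  | succ n => simp [partialEval, coeff_one]

lemma partialEval_pow_le {ρ : ℝ} (hρ : 0 ≤ ρ) {f : PowerSeries ℝ}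
    (hf : ∀ n, 0 ≤ coeff n f) (n k : ℕ) :
    partialEval ρ n (f ^ k) ≤ partialEval ρ n f ^ k := by
  induction k with
  | zero => simpa using partialEval_one_le ρ n
  | succ k ih =>
    rw [pow_succ, pow_succ]
    exact (partialEval_mul_le hρ (coeff_pow_nonneg hf k) hf n).trans
      (mul_le_mul_of_nonneg_right ih (partialEval_nonneg hρ hf n))

lemma sum_pow_le_two {x : ℝ} (hx0 : 0 ≤ x) (hx : x ≤ 1 / 2) (n : ℕ) :
    ∑ k ∈ Finset.range n, x ^ k ≤ 2 := by
  calc ∑ k ∈ Finset.range n, x ^ k ≤ ∑ k ∈ Finset.range n, (1 / 2 : ℝ) ^ k :=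
        Finset.sum_le_sum fun k _ => pow_le_pow_left₀ hx0 hx k
    _ ≤ 2 := sum_geometric_two_le n

lemma partialEval_X_mul (ρ : ℝ) (f : PowerSeries ℝ) (n : ℕ) :
    partialEval ρ (n + 1) (X * f) = ρ * partialEval ρ n f := by
  unfold partialEval
  rw [Finset.sum_range_succ', Finset.mul_sum]
  simp only [coeff_succ_X_mul, coeff_zero_X_mul, zero_mul, add_zero]
  exact Finset.sum_congr rfl fun i _ => by ring

/-- The series `t (1 + m D(t))`, which dominates the primitive of `1 + m D(t)`. -/
noncomputable def inputMajorant (m : ℕ) (D : PowerSeries ℝ) : PowerSeries ℝ :=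
  X * (1 + C (m : ℝ) * D)

/-- The series with coefficients `∑_{k ≤ n} K M^k (U^k)_n`, where `U = t (1 + m D(t))`;
it is the composite of `K / (1 - M t)` with `U`. -/
noncomputable def compMajorant (m : ℕ) (K M : ℝ) (D : PowerSeries ℝ) : PowerSeries ℝ :=
  PowerSeries.mk fun n => ∑ k ∈ Finset.range (n + 1),
    K * M ^ k * coeff n (inputMajorant m D ^ k)

lemma coeff_one_add_C_mul_nonneg (m : ℕ) {D : PowerSeries ℝ} (hD : ∀ n, 0 ≤ coeff n D)
    (n : ℕ) : 0 ≤ coeff n (1 + C (m : ℝ) * D) := by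
  rw [map_add, coeff_C_mul, coeff_one]
  have := hD n
  split_ifs <;> positivity

lemma coeff_inputMajorant_nonneg (m : ℕ) {D : PowerSeries ℝ} (hD : ∀ n, 0 ≤ coeff n D)
    (n : ℕ) : 0 ≤ coeff n (inputMajorant m D) := by
  cases n with
  | zero => simp [inputMajorant]
  | succ n =>
    rw [inputMajorant, coeff_succ_X_mul]
    exact coeff_one_add_C_mul_nonneg m hD n

lemma coeff_le_coeff_derivative_inputMajorant (m : ℕ) {D : PowerSeries ℝ}
    (hD : ∀ n, 0 ≤ coeff n D) (n : ℕ) :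
    coeff n (1 + C (m : ℝ) * D) ≤ coeff n (derivative ℝ (inputMajorant m D)) := by
  rw [coeff_derivative, inputMajorant, coeff_succ_X_mul]
  have h := coeff_one_add_C_mul_nonneg m hD n
  nlinarith [mul_nonneg h (Nat.cast_nonneg (α := ℝ) n)]

lemma coeff_compMajorant_nonneg (m : ℕ) {K M : ℝ} (hK : 0 ≤ K) (hM : 0 ≤ M)
    {D : PowerSeries ℝ} (hD : ∀ n, 0 ≤ coeff n D) (n : ℕ) :
    0 ≤ coeff n (compMajorant m K M D) := by
  rw [compMajorant, coeff_mk]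
  exact Finset.sum_nonneg fun k _ =>
    mul_nonneg (by positivity) (coeff_pow_nonneg (coeff_inputMajorant_nonneg m hD) k n)

lemma partialEval_compMajorant_le (m : ℕ) {K M ρ S : ℝ} (hK : 0 ≤ K) (hM : 0 ≤ M)
    (hρ : 0 ≤ ρ) {D : PowerSeries ℝ} (hD : ∀ n, 0 ≤ coeff n D) (n : ℕ)
    (hS : partialEval ρ n D ≤ S) (hsmall : M * (ρ * (1 + m * S)) ≤ 1 / 2) :
    partialEval ρ (n + 1) (compMajorant m K M D) ≤ 2 * K := by
  have hU := coeff_inputMajorant_nonneg m hD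
  set U := inputMajorant m D with hUdef
  have hUeval : partialEval ρ (n + 1) U ≤ ρ * (1 + m * S) := by
    rw [hUdef, inputMajorant, partialEval_X_mul]
    refine mul_le_mul_of_nonneg_left ?_ hρ
    have : partialEval ρ n (1 + C (m : ℝ) * D) = partialEval ρ n 1 + m * partialEval ρ n D := by
      simp only [partialEval, map_add, coeff_C_mul, add_mul, Finset.sum_add_distrib,
        Finset.mul_sum, mul_assoc]
    rw [this]
    exact add_le_add (partialEval_one_le ρ n) (mul_le_mul_of_nonneg_left hS (Nat.cast_nonneg m))
  have hU0 := partialEval_nonneg hρ hU (n + 1)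
  calc partialEval ρ (n + 1) (compMajorant m K M D)
      ≤ ∑ i ∈ Finset.range (n + 1), ∑ k ∈ Finset.range (n + 1),
          K * M ^ k * (coeff i (U ^ k) * ρ ^ i) := by
        refine Finset.sum_le_sum fun i hi => ?_
        rw [compMajorant, coeff_mk, Finset.sum_mul]
        simp_rw [mul_assoc]
        refine Finset.sum_le_sum_of_subset_of_nonneg (Finset.range_mono ?_) fun k _ _ => ?_
        · have := Finset.mem_range.1 hi; omega
        · have := coeff_pow_nonneg hU k i
          positivity
    _ = ∑ k ∈ Finset.range (n + 1), K * M ^ k * partialEval ρ (n + 1) (U ^ k) := by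
        rw [Finset.sum_comm]
        simp only [partialEval, Finset.mul_sum]
    _ ≤ ∑ k ∈ Finset.range (n + 1), K * (M * partialEval ρ (n + 1) U) ^ k := by
        refine Finset.sum_le_sum fun k _ => ?_
        rw [mul_pow, ← mul_assoc]
        exact mul_le_mul_of_nonneg_left (partialEval_pow_le hρ hU (n + 1) k) (by positivity)
    _ ≤ 2 * K := by
        rw [← Finset.mul_sum, mul_comm]
        refine mul_le_mul_of_nonneg_right (sum_pow_le_two (by positivity) ?_ _) hK
        exact (mul_le_mul_of_nonneg_left hUeval hM).trans hsmall

end PowerSeriesBounds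

section SeriesBounds

open PowerSeries

lemma majorizes_leftQuot {m : ℕ} {f : PowerSeries ℝ} {c : Series m} (h : Majorizes f c)
    (i : Fin (m + 1)) : Majorizes (derivative ℝ f) (fun w => c (i :: w)) := by
  intro η
  have := h (i :: η)
  rw [List.length_cons, Nat.factorial_succ] at this
  rw [coeff_derivative]
  push_cast at this
  linarith

/-- A shuffle product is dominated by the product of the dominating series, uniformly over
a finite family in the second argument. -/
lemma sum_abs_shuffle_le {m : ℕ} {ι : Type*} (s : Finset ι) {f g : PowerSeries ℝ}
    {c : Series m} {e : ι → Series m} (hc : Majorizes f c)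
    (he : Majorizes g fun η => ∑ a ∈ s, |e a η|) :
    Majorizes (f * g) fun η => ∑ a ∈ s, |shuffle c (e a) η| := by
  intro η
  induction η generalizing f g c e with
  | nil =>
    have h1 := hc []
    have h2 := he []
    simp only [List.length_nil, Nat.factorial_zero, Nat.cast_one, one_mul, shuffle, abs_mul,
      coeff_zero_eq_constantCoeff, map_mul, ← Finset.mul_sum] at h1 h2 ⊢
    rw [abs_abs]
    exact mul_le_mul h1 h2 (abs_nonneg _) ((abs_nonneg _).trans h1)
  | cons i η ih =>
    have h1 := ih (majorizes_leftQuot hc i) he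
    have h2 := ih (e := fun a w => e a (i :: w)) hc (majorizes_leftQuot he i)
    have h3 : ∑ a ∈ s, |shuffle c (e a) (i :: η)| ≤
        ∑ a ∈ s, |shuffle (fun w => c (i :: w)) (e a) η| +
        ∑ a ∈ s, |shuffle c (fun w => e a (i :: w)) η| := by
      rw [← Finset.sum_add_distrib]
      exact Finset.sum_le_sum fun a _ => abs_add_le _ _
    have h4 : ((Nat.factorial (i :: η).length : ℕ) : ℝ) * coeff (i :: η).length (f * g) =
        (Nat.factorial η.length : ℝ) * coeff η.length (derivative ℝ f * g) +
        (Nat.factorial η.length : ℝ) * coeff η.length (f * derivative ℝ g) := by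
      rw [← mul_add, ← map_add, List.length_cons, Nat.factorial_succ]
      have : derivative ℝ f * g + f * derivative ℝ g = derivative ℝ (f * g) := by
        rw [Derivation.leibniz, smul_eq_mul, smul_eq_mul]; ring
      rw [this, coeff_derivative]
      push_cast
      ring
    have h5 := le_abs_self (∑ a ∈ s, |shuffle (fun w => c (i :: w)) (e a) η|)
    have h6 := le_abs_self (∑ a ∈ s, |shuffle c (fun w => e a (i :: w)) η|)
    rw [abs_of_nonneg (Finset.sum_nonneg fun a _ => abs_nonneg _), h4]
    linarith

lemma shuffle_zero_left {m : ℕ} (e : Series m) (η : Word m) : shuffle 0 e η = 0 := by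
  induction η generalizing e with
  | nil => simp [shuffle]
  | cons i η ih =>
    change shuffle 0 e η + shuffle 0 (fun w => e (i :: w)) η = 0
    rw [ih, ih, add_zero]

lemma sum_abs_phiLetter_le {m : ℕ} {ι : Type*} (s : Finset ι) {D Q : PowerSeries ℝ}
    {d : Fin m → Series m} {e : ι → Series m} (hd : ∀ i, Majorizes D (d i))
    (he : Majorizes Q fun η => ∑ a ∈ s, |e a η|) (j : Fin (m + 1)) (ν : Word m) :
    ∑ ℓ, ∑ a ∈ s, |phiLetter d ℓ (e a) (j :: ν)| ≤
      (Nat.factorial ν.length : ℝ) * coeff ν.length (Q * (1 + C (m : ℝ) * D)) := by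
  have h1 : ∀ ℓ a, |phiLetter d ℓ (e a) (j :: ν)| ≤
      (if j = ℓ then |e a ν| else 0) + |shuffle (dhat d ℓ) (e a) ν| := by
    intro ℓ a
    refine (abs_add_le _ _).trans (add_le_add ?_ ?_)
    · simp only [prepend]; split_ifs <;> simp
    · simp only [prepend]; split_ifs <;> simp
  have h2 : ∑ ℓ : Fin (m + 1), ∑ a ∈ s, |shuffle (dhat d ℓ) (e a) ν| ≤
      m * ((Nat.factorial ν.length : ℝ) * coeff ν.length (D * Q)) := by
    rw [Fin.sum_univ_succ]
    have h0 : ∑ a ∈ s, |shuffle (dhat d 0) (e a) ν| = 0 :=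
      Finset.sum_eq_zero fun a _ => by
        rw [show dhat d 0 = 0 from rfl, shuffle_zero_left, abs_zero]
    rw [h0, zero_add]
    calc _ ≤ ∑ _i : Fin m, (Nat.factorial ν.length : ℝ) * coeff ν.length (D * Q) :=
          Finset.sum_le_sum fun i _ =>
            (le_abs_self _).trans (sum_abs_shuffle_le s (hd i) he ν)
      _ = _ := by simp
  calc ∑ ℓ, ∑ a ∈ s, |phiLetter d ℓ (e a) (j :: ν)|
      ≤ ∑ ℓ, ∑ a ∈ s, ((if j = ℓ then |e a ν| else 0) + |shuffle (dhat d ℓ) (e a) ν|) :=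
        Finset.sum_le_sum fun ℓ _ => Finset.sum_le_sum fun a _ => h1 ℓ a
    _ = ∑ a ∈ s, |e a ν| + ∑ ℓ, ∑ a ∈ s, |shuffle (dhat d ℓ) (e a) ν| := by
        simp_rw [Finset.sum_add_distrib]
        rw [Finset.sum_comm (t := s)]
        simp
    _ ≤ (Nat.factorial ν.length : ℝ) * coeff ν.length Q +
          m * ((Nat.factorial ν.length : ℝ) * coeff ν.length (D * Q)) :=
        add_le_add ((le_abs_self _).trans (he ν)) h2
    _ = _ := by
        rw [show Q * (1 + C (m : ℝ) * D) = Q + C (m : ℝ) * (D * Q) by ring, map_add,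
          coeff_C_mul]
        ring

/-- The total mass of `φ_d(η)(1)` over the words `η` of length `k` is dominated by
`U^k / k!` with `U = t (1 + m D(t))`. -/
lemma majorizes_sum_abs_phi {m : ℕ} {D : PowerSeries ℝ} (hD : ∀ n, 0 ≤ coeff n D)
    {d : Fin m → Series m} (hd : ∀ i, Majorizes D (d i)) (k : ℕ) :
    Majorizes (C ((Nat.factorial k : ℝ)⁻¹) * inputMajorant m D ^ k)
      (fun ν => ∑ η : Fin k → Fin (m + 1), |phi d (List.ofFn η) oneSeries ν|) := by
  have hU := coeff_inputMajorant_nonneg m hD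
  induction k with
  | zero =>
    intro ν
    cases ν <;> simp [phi, oneSeries, coeff_one]
  | succ k ih =>
    have hsum : ∀ ν : Word m,
        ∑ η : Fin (k + 1) → Fin (m + 1), |phi d (List.ofFn η) oneSeries ν| =
          ∑ ℓ, ∑ η : Fin k → Fin (m + 1),
            |phiLetter d ℓ (phi d (List.ofFn η) oneSeries) ν| := by
      intro ν
      rw [← Fintype.sum_prod_type', ← (Fin.consEquiv fun _ => Fin (m + 1)).sum_comp]
      refine Finset.sum_congr rfl fun p _ => ?_
      simp [Fin.consEquiv, phi]
    intro ν
    simp only [hsum]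
    rw [abs_of_nonneg (Finset.sum_nonneg fun _ _ => Finset.sum_nonneg fun _ _ => abs_nonneg _)]
    cases ν with
    | nil =>
      rw [coeff_C_mul]
      have := coeff_pow_nonneg hU (k + 1) ([] : Word m).length
      simp only [phiLetter, prepend, Pi.add_apply, add_zero, abs_zero, Finset.sum_const_zero]
      positivity
    | cons j ν =>
      set U := inputMajorant m D with hUdef
      have hQ : ∀ n, 0 ≤ coeff n (C ((Nat.factorial k : ℝ)⁻¹) * U ^ k) := fun n => by
        rw [coeff_C_mul]
        have := coeff_pow_nonneg hU k n
        positivity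
      refine (sum_abs_phiLetter_le Finset.univ hd ih j ν).trans ?_
      have hder : derivative ℝ (C ((Nat.factorial (k + 1) : ℝ)⁻¹) * U ^ (k + 1)) =
          C ((Nat.factorial k : ℝ)⁻¹) * U ^ k * derivative ℝ U := by
        rw [← smul_eq_C_mul, ← smul_eq_C_mul, Derivation.map_smul, Derivation.leibniz_pow,
          Nat.add_sub_cancel, ← Nat.cast_smul_eq_nsmul ℝ, smul_smul, Nat.factorial_succ,
          smul_eq_mul, smul_mul_assoc]
        congr 1
        push_cast
        field_simp
      calc _ ≤ (Nat.factorial ν.length : ℝ) * coeff ν.length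
              (C ((Nat.factorial k : ℝ)⁻¹) * U ^ k * derivative ℝ U) :=
            mul_le_mul_of_nonneg_left
              (coeff_mul_le_coeff_mul hQ (coeff_le_coeff_derivative_inputMajorant m hD) _)
              (Nat.cast_nonneg _)
        _ = _ := by
            rw [← hder, coeff_derivative, List.length_cons, Nat.factorial_succ ν.length]
            push_cast
            ring

lemma majorizes_modComp {m : ℕ} {K M : ℝ} (hK : 0 ≤ K) (hM : 0 ≤ M) {D : PowerSeries ℝ}
    (hD : ∀ n, 0 ≤ coeff n D) {c : Series m} {d : Fin m → Series m}
    (hc : ∀ η, |c η| ≤ K * M ^ η.length * (Nat.factorial η.length : ℝ))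
    (hd : ∀ i, Majorizes D (d i)) : Majorizes (compMajorant m K M D) (modComp c d) := by
  intro ν
  rw [compMajorant, coeff_mk, Finset.mul_sum, modComp]
  refine (Finset.abs_sum_le_sum_abs _ _).trans (Finset.sum_le_sum fun k _ => ?_)
  have hk := (le_abs_self _).trans (majorizes_sum_abs_phi hD hd k ν)
  rw [coeff_C_mul] at hk
  calc _ ≤ ∑ η : Fin k → Fin (m + 1), |c (List.ofFn η) * phi d (List.ofFn η) oneSeries ν| :=
        Finset.abs_sum_le_sum_abs _ _
    _ ≤ ∑ η : Fin k → Fin (m + 1),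
          K * M ^ k * (Nat.factorial k : ℝ) * |phi d (List.ofFn η) oneSeries ν| := by
        refine Finset.sum_le_sum fun η _ => ?_
        rw [abs_mul]
        have := hc (List.ofFn η)
        rw [List.length_ofFn] at this
        exact mul_le_mul_of_nonneg_right this (abs_nonneg _)
    _ ≤ _ := by
        rw [← Finset.mul_sum]
        refine (mul_le_mul_of_nonneg_left hk (by positivity)).trans (le_of_eq ?_)
        field_simp

lemma abs_le_of_partialEval_le {m : ℕ} {f : PowerSeries ℝ} (hf : ∀ n, 0 ≤ coeff n f)
    {c : Series m} (hc : Majorizes f c) {ρ B : ℝ} (hρ : 0 < ρ)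
    (hB : ∀ n, partialEval ρ n f ≤ B) (η : Word m) :
    |c η| ≤ B * ρ⁻¹ ^ η.length * (Nat.factorial η.length : ℝ) := by
  refine (hc η).trans ?_
  rw [mul_comm]
  refine mul_le_mul_of_nonneg_right ?_ (Nat.cast_nonneg _)
  have h := (coeff_mul_pow_le_partialEval hρ.le hf η.length).trans (hB _)
  rw [inv_pow, ← div_eq_mul_inv, le_div_iff₀ (by positivity)]
  exact h

lemma IsLocallyConvergent.add {m : ℕ} {c d : SeriesVec m m} (hc : IsLocallyConvergent c)
    (hd : IsLocallyConvergent d) : IsLocallyConvergent (c + d) := by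
  obtain ⟨K₁, M₁, hK₁, hM₁, h₁⟩ := hc
  obtain ⟨K₂, M₂, hK₂, hM₂, h₂⟩ := hd
  refine ⟨K₁ + K₂, max M₁ M₂, by positivity, lt_max_of_lt_left hM₁, fun η i => ?_⟩
  calc |c i η + d i η| ≤ |c i η| + |d i η| := abs_add_le _ _
    _ ≤ K₁ * M₁ ^ η.length * (Nat.factorial η.length : ℝ) +
          K₂ * M₂ ^ η.length * (Nat.factorial η.length : ℝ) := add_le_add (h₁ η i) (h₂ η i)
    _ ≤ K₁ * max M₁ M₂ ^ η.length * (Nat.factorial η.length : ℝ) +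
          K₂ * max M₁ M₂ ^ η.length * (Nat.factorial η.length : ℝ) := by
        gcongr
        · exact le_max_left _ _
        · exact le_max_right _ _
    _ = _ := by ring

lemma exists_pos_mul_le_half {A : ℝ} (hA : 0 < A) : ∃ ρ : ℝ, 0 < ρ ∧ A * ρ ≤ 1 / 2 :=
  ⟨1 / (2 * A), by positivity, le_of_eq (by field_simp)⟩

lemma IsLocallyConvergent.modCompVec {m : ℕ} {c d : SeriesVec m m}
    (hc : IsLocallyConvergent c) (hd : IsLocallyConvergent d) :
    IsLocallyConvergent (modCompVec c d) := by
  obtain ⟨K, M, hK, hM, hc⟩ := hc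
  obtain ⟨K₂, M₂, hK₂, hM₂, hd⟩ := hd
  set D : PowerSeries ℝ := PowerSeries.mk fun n => K₂ * M₂ ^ n with hDdef
  have hD : ∀ n, 0 ≤ coeff n D := fun n => by rw [hDdef, coeff_mk]; positivity
  have hdD : ∀ i, Majorizes D (d i) := fun i η => by
    rw [hDdef, coeff_mk, mul_comm]; exact hd η i
  obtain ⟨ρ, hρ, hsmall⟩ :=
    exists_pos_mul_le_half (A := M * (1 + m * (2 * K₂)) + M₂) (by positivity)
  have hρ₁ : M * (ρ * (1 + m * (2 * K₂))) ≤ 1 / 2 := by nlinarith [mul_pos hM₂ hρ]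
  have hρ₂ : M₂ * ρ ≤ 1 / 2 := by
    have : 0 ≤ M * (1 + m * (2 * K₂)) * ρ := by positivity
    linarith
  have hS : ∀ n, partialEval ρ n D ≤ 2 * K₂ := fun n => by
    calc partialEval ρ n D = K₂ * ∑ i ∈ Finset.range n, (M₂ * ρ) ^ i := by
          simp only [partialEval, hDdef, coeff_mk, Finset.mul_sum, mul_pow, mul_assoc]
      _ ≤ 2 * K₂ := by
          rw [mul_comm 2]
          exact mul_le_mul_of_nonneg_left (sum_pow_le_two (by positivity) hρ₂ n) hK₂.le
  refine ⟨2 * K, ρ⁻¹, by positivity, by positivity, fun η i => ?_⟩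
  refine abs_le_of_partialEval_le (coeff_compMajorant_nonneg m hK.le hM.le hD)
    (majorizes_modComp hK.le hM.le hD (fun η => hc η i) hdD) hρ (fun n => ?_) η
  cases n with
  | zero => simpa [partialEval] using hK.le
  | succ n => exact partialEval_compMajorant_le m hK.le hM.le hρ.le hD n (hS n) hρ₁

/-- The least series dominating every component of `c`. -/
noncomputable def leastMajorant {m : ℕ} (c : SeriesVec m m) : PowerSeries ℝ :=
  PowerSeries.mk fun n => ⨆ p : Fin m × (Fin n → Fin (m + 1)),
    |c p.1 (List.ofFn p.2)| / (Nat.factorial n : ℝ)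

lemma coeff_leastMajorant_nonneg {m : ℕ} (c : SeriesVec m m) (n : ℕ) :
    0 ≤ coeff n (leastMajorant c) := by
  rw [leastMajorant, coeff_mk]
  exact Real.iSup_nonneg fun p => by positivity

lemma majorizes_leastMajorant {m : ℕ} (c : SeriesVec m m) (i : Fin m) :
    Majorizes (leastMajorant c) (c i) := by
  intro η
  rw [leastMajorant, coeff_mk, ← div_le_iff₀' (by positivity)]
  have := le_ciSup (f := fun p : Fin m × (Fin η.length → Fin (m + 1)) =>
    |c p.1 (List.ofFn p.2)| / (Nat.factorial η.length : ℝ))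
    (Set.finite_range _).bddAbove (i, η.get)
  simpa using this

lemma coeff_leastMajorant_le {m : ℕ} {c : SeriesVec m m} {f : PowerSeries ℝ}
    (hf : ∀ n, 0 ≤ coeff n f) (h : ∀ i, Majorizes f (c i)) (n : ℕ) :
    coeff n (leastMajorant c) ≤ coeff n f := by
  rw [leastMajorant, coeff_mk]
  refine Real.iSup_le (fun p => ?_) (hf n)
  rw [div_le_iff₀' (by positivity)]
  simpa using h p.1 (List.ofFn p.2)

lemma isLocallyConvergent_of_eq_modCompVec {m : ℕ} {c e : SeriesVec m m}
    (hc : IsLocallyConvergent c) (he : e = modCompVec c e) : IsLocallyConvergent e := by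
  obtain ⟨K, M, hK, hM, hc⟩ := hc
  obtain ⟨ρ, hρ, hsmall⟩ := exists_pos_mul_le_half (A := M * (1 + m * (2 * K))) (by positivity)
  have hρ₁ : M * (ρ * (1 + m * (2 * K))) ≤ 1 / 2 := by linarith
  have hE := coeff_leastMajorant_nonneg e
  have hle : ∀ n, coeff n (leastMajorant e) ≤ coeff n (compMajorant m K M (leastMajorant e)) := by
    refine coeff_leastMajorant_le (coeff_compMajorant_nonneg m hK.le hM.le hE) fun i => ?_
    have := majorizes_modComp hK.le hM.le hE (fun η => hc η i) (majorizes_leastMajorant e)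
    exact (congrFun he i).symm ▸ this
  have hS : ∀ n, partialEval ρ n (leastMajorant e) ≤ 2 * K := by
    intro n
    induction n with
    | zero => simpa [partialEval] using hK.le
    | succ n ih =>
      refine le_trans (Finset.sum_le_sum fun i _ => ?_)
        (partialEval_compMajorant_le m hK.le hM.le hρ.le hE n ih hρ₁)
      exact mul_le_mul_of_nonneg_right (hle i) (by positivity)
  exact ⟨2 * K, ρ⁻¹, by positivity, by positivity, fun η i =>
    abs_le_of_partialEval_le hE (majorizes_leastMajorant e i) hρ hS η⟩

end SeriesBounds

/-- the locally convergent series form a subgroup of the output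
feedback group `(ℝ^m⟨⟨X⟩⟩, ⊚)` with identity `0`: the identity is locally
convergent, local convergence is preserved by the group product
`c ⊚ d = d + c ∘̃ d`, and by the composition inverse `c⁻¹` (the unique series
with `c⁻¹ = (−c) ∘̃ c⁻¹`). -/
theorem locallyConvergent_subgroup (m : ℕ) :
    IsLocallyConvergent (0 : SeriesVec m m) ∧
    (∀ c d : SeriesVec m m,
      IsLocallyConvergent c → IsLocallyConvergent d → IsLocallyConvergent (oplus c d)) ∧
    (∀ c cinv : SeriesVec m m,
      IsLocallyConvergent c → cinv = modCompVec (-c) cinv → IsLocallyConvergent cinv) := by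
  refine ⟨⟨1, 1, one_pos, one_pos, fun η i => ?_⟩, fun c d hc hd => hd.add (hc.modCompVec hd),
    fun c cinv hc h => isLocallyConvergent_of_eq_modCompVec (c := -c) ?_ h⟩
  · simp
  · obtain ⟨K, M, hK, hM, hc⟩ := hc
    exact ⟨K, M, hK, hM, fun η i => by simpa using hc η i⟩
end

section
/- If c ∈ ℝ^m⟨⟨X⟩⟩ and d ∈ ℝ^m⟨⟨X⟩⟩ are both locally convergent, then the feedback product c @ d (the unique series satisfying c @ d = c ∘̃ (d ∘ (c @ d))) is locally convergent. -/
open scoped BigOperators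

open PowerSeries Nat

/-- `F` dominates `a` on words of length `< N`, as an exponential generating function. -/
def DominatedBelow {m : ℕ} (N : ℕ) (a : Series m) (F : ℝ⟦X⟧) : Prop :=
  ∀ ν : Word m, ν.length < N → |a ν| ≤ (ν.length)! * coeff ν.length F

/-- The two generating functions `Y = 1 - √(1 - 2lt)` and `G = 1 / √(1 - 2lt)`, characterised by
`Y' = l G` and `G (1 - Y) = 1`, together with the coefficient bounds used below. -/
structure IsMajorantPair (l : ℝ) (Y G : ℝ⟦X⟧) : Prop where
  coeff_left_nonneg : ∀ n, 0 ≤ coeff n Y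
  coeff_right_nonneg : ∀ n, 0 ≤ coeff n G
  coeff_zero_right : coeff 0 G = 1
  derivative_left : derivative ℝ Y = C l * G
  right_mul_one_sub_left : G * (1 - Y) = 1
  coeff_right_le : ∀ n, coeff n G ≤ (2 * l) ^ n

lemma exists_isMajorantPair {l : ℝ} (hl : 0 < l) : ∃ Y G : ℝ⟦X⟧, IsMajorantPair l Y G := by
  set G : ℝ⟦X⟧ := mk fun n => (l / 2) ^ n * (centralBinom n : ℝ) with hG
  set S : ℝ⟦X⟧ := rescale (l / 2) (PowerSeries.map (Nat.castRingHom ℝ) catalanSeries) with hS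
  set Q : ℝ⟦X⟧ := C (l / 2) * X * S with hQ
  have hS_quad : S ^ 2 * (C (l / 2) * X) + 1 = S := by
    have h := congrArg (fun f => rescale (l / 2) (PowerSeries.map (Nat.castRingHom ℝ) f))
      catalanSeries_sq_mul_X_add_one
    simpa [rescale_X] using h
  have hQ_quad : Q = Q * Q + C (l / 2) * X := by
    rw [hQ]
    linear_combination (-(C (l / 2) * X)) * hS_quad
  have hQ_coeff : ∀ n, coeff (n + 1) Q = (l / 2) * ((l / 2) ^ n * (catalan n : ℝ)) := by
    intro n
    rw [hQ, mul_assoc, coeff_C_mul, coeff_succ_X_mul, hS]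
    simp
  have hQ_zero : coeff 0 Q = 0 := by simp [hQ]
  have hQ_deriv : derivative ℝ Q = C (l / 2) * G := by
    ext n
    rw [coeff_derivative, hQ_coeff, coeff_C_mul, hG, coeff_mk,
      ← succ_mul_catalan_eq_centralBinom]
    push_cast
    ring
  have hQ_nonneg : ∀ n, 0 ≤ coeff n Q := by
    rintro (_ | n)
    · exact hQ_zero.ge
    · rw [hQ_coeff]; positivity
  have hC : C (l / 2) ≠ (0 : ℝ⟦X⟧) := by
    rw [Ne, map_eq_zero_iff _ C_injective]
    positivity
  refine ⟨C 2 * Q, G, ?_, ?_, ?_, ?_, ?_, ?_⟩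
  · intro n
    rw [coeff_C_mul]
    exact mul_nonneg zero_le_two (hQ_nonneg n)
  · intro n
    rw [hG, coeff_mk]; positivity
  · simp [hG]
  · rw [Derivation.leibniz, hQ_deriv, derivative_C, smul_zero, add_zero, smul_eq_mul, ← mul_assoc,
      ← map_mul]
    congr 2
    ring
  · have h : derivative ℝ Q = Q * derivative ℝ Q + Q * derivative ℝ Q + C (l / 2) := by
      conv_lhs => rw [hQ_quad]
      simp [Derivation.leibniz]
    rw [hQ_deriv] at h
    refine mul_left_cancel₀ hC ?_
    have h2 : (C 2 : ℝ⟦X⟧) = 2 := map_ofNat C 2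
    rw [h2]
    linear_combination h
  · intro n
    rw [hG, coeff_mk]
    calc (l / 2) ^ n * (centralBinom n : ℝ) ≤ (l / 2) ^ n * (4 : ℝ) ^ n := by
          gcongr
          exact_mod_cast centralBinom_le_four_pow n
      _ = (2 * l) ^ n := by rw [← mul_pow]; ring_nf

lemma coeff_mul_nonneg_s14 {F H : ℝ⟦X⟧} (hF : ∀ n, 0 ≤ coeff n F) (hH : ∀ n, 0 ≤ coeff n H) (n : ℕ) :
    0 ≤ coeff n (F * H) := by
  rw [coeff_mul]
  exact Finset.sum_nonneg fun p _ => mul_nonneg (hF _) (hH _)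

lemma coeff_pow_nonneg_s14 {F : ℝ⟦X⟧} (hF : ∀ n, 0 ≤ coeff n F) (k n : ℕ) : 0 ≤ coeff n (F ^ k) := by
  induction k generalizing n with
  | zero =>
    rw [pow_zero, coeff_one]
    split_ifs <;> norm_num
  | succ k ih => exact pow_succ F k ▸ coeff_mul_nonneg_s14 ih hF n

lemma coeff_le_coeff_mul {F H : ℝ⟦X⟧} (hF : ∀ n, 0 ≤ coeff n F) (hF0 : coeff 0 F = 1)
    (hH : ∀ n, 0 ≤ coeff n H) (n : ℕ) : coeff n H ≤ coeff n (F * H) := by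
  rw [coeff_mul]
  calc coeff n H = coeff 0 F * coeff n H := by rw [hF0, one_mul]
    _ ≤ _ := Finset.single_le_sum (f := fun p : ℕ × ℕ => coeff p.1 F * coeff p.2 H)
        (fun p _ => mul_nonneg (hF _) (hH _)) (a := (0, n)) (by simp)

lemma factorial_mul_coeff_derivative (F : ℝ⟦X⟧) (n : ℕ) :
    (n ! : ℝ) * coeff n (derivative ℝ F) = ((n + 1)! : ℝ) * coeff (n + 1) F := by
  rw [coeff_derivative, factorial_succ]
  push_cast
  ring

namespace IsMajorantPair

variable {l : ℝ} {Y G : ℝ⟦X⟧}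

lemma sum_coeff_pow_le (h : IsMajorantPair l Y G) (N n : ℕ) :
    ∑ k ∈ Finset.range N, coeff n (Y ^ k) ≤ coeff n G := by
  have hsum : ∑ k ∈ Finset.range N, Y ^ k = G - G * Y ^ N := by
    have hgeom := mul_neg_geom_sum Y N
    linear_combination G * hgeom - (∑ k ∈ Finset.range N, Y ^ k) * h.right_mul_one_sub_left
  rw [← map_sum, hsum, map_sub]
  linarith [coeff_mul_nonneg_s14 h.coeff_right_nonneg (coeff_pow_nonneg_s14 h.coeff_left_nonneg N) n]

lemma derivative_pow_succ (h : IsMajorantPair l Y G) (k : ℕ) :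
    derivative ℝ (Y ^ (k + 1)) = C ((k + 1) * l) * (G * Y ^ k) := by
  rw [PowerSeries.derivative_pow, h.derivative_left]
  simp
  ring

end IsMajorantPair

namespace DominatedBelow

variable {m : ℕ} {N : ℕ} {a b : Series m} {F H : ℝ⟦X⟧}

lemma mono {N' : ℕ} (h : DominatedBelow N a F) (hN : N' ≤ N) : DominatedBelow N' a F :=
  fun ν hν => h ν (hν.trans_le hN)

lemma leftQuot (h : DominatedBelow (N + 1) a F) (i : Fin (m + 1)) :
    DominatedBelow N (leftQuot i a) (derivative ℝ F) := by
  intro ν hν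
  rw [factorial_mul_coeff_derivative]
  exact h (i :: ν) (by simpa using hν)

lemma shuffle (ha : DominatedBelow N a F) (hb : DominatedBelow N b H) :
    DominatedBelow N (shuffle a b) (F * H) := by
  intro ν
  induction ν generalizing N a b F H with
  | nil =>
    intro hν
    have h1 := ha [] hν
    have h2 := hb [] hν
    simp only [List.length_nil, factorial_zero, cast_one, one_mul] at h1 h2 ⊢
    rw [_root_.shuffle, abs_mul, coeff_mul]
    simpa using mul_le_mul h1 h2 (abs_nonneg _) ((abs_nonneg _).trans h1)
  | cons i ν ih =>
    intro hν
    obtain ⟨N, rfl⟩ : ∃ N', N = N' + 1 := ⟨N - 1, by grind⟩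
    have hν' : ν.length < N := by simpa using hν
    have h1 := ih (ha.leftQuot i) (hb.mono N.le_succ) hν'
    have h2 := ih (ha.mono N.le_succ) (hb.leftQuot i) hν'
    rw [List.length_cons, ← factorial_mul_coeff_derivative, Derivation.leibniz, smul_eq_mul,
      smul_eq_mul, map_add, mul_add, mul_comm H]
    exact (abs_add_le _ _).trans ((add_le_add h1 h2).trans_eq (add_comm _ _))

lemma oneSeries : DominatedBelow N (oneSeries : Series m) 1 := by
  rintro (_ | ⟨i, ν⟩) _ <;> simp [_root_.oneSeries, coeff_one]

end DominatedBelow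

/-- The common estimate satisfied by the letter operators `φ_d(x_ℓ)` and `ψ_d(x_ℓ)` when `d` is
dominated by a multiple of `G`: they act like integration after multiplication by `A G`. -/
def IsIntegralLike {m : ℕ} (N : ℕ) (A : ℝ) (G : ℝ⟦X⟧) (L : Fin (m + 1) → Series m → Series m) :
    Prop :=
  ∀ (ℓ : Fin (m + 1)) (e : Series m) (E : ℝ⟦X⟧), (∀ n, 0 ≤ coeff n E) → DominatedBelow N e E →
    L ℓ e [] = 0 ∧ ∀ (j : Fin (m + 1)) (ν : Word m), ν.length < N →
      |L ℓ e (j :: ν)| ≤ (ν.length)! * (A * coeff ν.length (G * E))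

section Letters

variable {m N : ℕ} {K l : ℝ} {Y G : ℝ⟦X⟧} {d : Fin m → Series m}

lemma abs_prepend_cons_le (ℓ j : Fin (m + 1)) (e : Series m) (ν : Word m) :
    |prepend ℓ e (j :: ν)| ≤ |e ν| := by
  rw [prepend]
  split_ifs <;> simp

lemma isIntegralLike_phiLetter (hG : IsMajorantPair l Y G) (hK : 0 ≤ K)
    (hd : ∀ i, DominatedBelow N (d i) (C K * G)) : IsIntegralLike N (1 + K) G (phiLetter d) := by
  intro ℓ e E hE he
  refine ⟨by simp [phiLetter, prepend], fun j ν hν => ?_⟩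
  have hdhat : DominatedBelow N (dhat d ℓ) (C K * G) := by
    cases ℓ using Fin.cases with
    | zero =>
      intro ν _
      have := hG.coeff_right_nonneg ν.length
      simp only [dhat, Fin.cases_zero, Pi.zero_apply, abs_zero, coeff_C_mul]
      positivity
    | succ i => exact hd i
  have h1 : |prepend ℓ e (j :: ν)| ≤ (ν.length)! * coeff ν.length (G * E) :=
    (abs_prepend_cons_le ℓ j e ν).trans <| (he ν hν).trans <| by
      gcongr
      exact coeff_le_coeff_mul hG.coeff_right_nonneg hG.coeff_zero_right hE _
  have h2 : |prepend 0 (shuffle (dhat d ℓ) e) (j :: ν)|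
      ≤ (ν.length)! * (K * coeff ν.length (G * E)) := by
    have := (abs_prepend_cons_le 0 j _ ν).trans (hdhat.shuffle he ν hν)
    rwa [mul_assoc, coeff_C_mul] at this
  calc |phiLetter d ℓ e (j :: ν)| ≤ _ := abs_add_le _ _
    _ ≤ _ := add_le_add h1 h2
    _ = _ := by ring

lemma isIntegralLike_psiLetter (hG : IsMajorantPair l Y G) (hK : 0 ≤ K)
    (hd : ∀ i, DominatedBelow N (d i) (C K * G)) : IsIntegralLike N (1 + K) G (psiLetter d) := by
  intro ℓ e E hE he
  refine ⟨by simp [psiLetter, prepend], fun j ν hν => ?_⟩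
  have hdtil : DominatedBelow N (dtil d ℓ) (C (1 + K) * G) := by
    intro ν hν
    have hGν := hG.coeff_right_nonneg ν.length
    rw [coeff_C_mul]
    cases ℓ using Fin.cases with
    | zero =>
      refine (DominatedBelow.oneSeries ν hν).trans ?_
      gcongr
      calc coeff ν.length (1 : ℝ⟦X⟧) ≤ coeff ν.length (G * 1) :=
            coeff_le_coeff_mul hG.coeff_right_nonneg hG.coeff_zero_right
              (fun n => by rw [coeff_one]; split_ifs <;> norm_num) _
        _ ≤ (1 + K) * coeff ν.length G := by
            rw [mul_one]
            nlinarith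
    | succ i =>
      refine (hd i ν hν).trans ?_
      rw [coeff_C_mul]
      gcongr
      linarith
  have := (abs_prepend_cons_le 0 j _ ν).trans (hdtil.shuffle he ν hν)
  rwa [mul_assoc, coeff_C_mul] at this

lemma phi_eq_foldr (η : Word m) (e : Series m) : phi d η e = η.foldr (phiLetter d) e := by
  induction η with
  | nil => rfl
  | cons ℓ η ih => rw [phi, ih, List.foldr_cons]

lemma psi_eq_foldr (η : Word m) (e : Series m) : psi d η e = η.foldr (psiLetter d) e := by
  induction η with
  | nil => rfl
  | cons ℓ η ih => rw [psi, ih, List.foldr_cons]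

end Letters

namespace IsIntegralLike

variable {m N : ℕ} {A K M R : ℝ} {Y G : ℝ⟦X⟧} {L : Fin (m + 1) → Series m → Series m}

lemma dominatedBelow_foldr (hL : IsIntegralLike N A G L) (hR : 0 < R)
    (hG : IsMajorantPair (A * R) Y G) (η : Word m) :
    DominatedBelow (N + 1) (η.foldr L oneSeries)
      (C (R ^ η.length * (η.length)!)⁻¹ * Y ^ η.length) := by
  have hnonneg : ∀ k n, 0 ≤ coeff n (C (R ^ k * (k ! : ℝ))⁻¹ * Y ^ k) := by
    intro k n
    have := coeff_pow_nonneg_s14 hG.coeff_left_nonneg k n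
    rw [coeff_C_mul]
    positivity
  induction η with
  | nil => simpa using DominatedBelow.oneSeries
  | cons ℓ η ih =>
    obtain ⟨hnil, hcons⟩ := hL ℓ _ _ (hnonneg _) (ih.mono N.le_succ)
    rintro (_ | ⟨j, ν⟩) hν
    · rw [List.foldr_cons, hnil, abs_zero]
      exact mul_nonneg (cast_nonneg _) (hnonneg _ _)
    · refine (hcons j ν (by simpa using hν)).trans_eq ?_
      rw [List.length_cons, List.length_cons, ← factorial_mul_coeff_derivative,
        Derivation.leibniz, derivative_C, smul_zero, add_zero, smul_eq_mul,
        hG.derivative_pow_succ, mul_left_comm G, coeff_C_mul, coeff_C_mul, coeff_C_mul,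
        factorial_succ]
      push_cast
      field_simp
      ring

lemma dominatedBelow_sum (hL : IsIntegralLike N A G L) (hK : 0 ≤ K) (hM : 0 < M)
    (hG : IsMajorantPair (A * (M * (m + 1))) Y G) {c : Series m}
    (hc : ∀ η : Word m, |c η| ≤ K * M ^ η.length * (η.length)!) :
    DominatedBelow (N + 1)
      (fun ν => ∑ k ∈ Finset.range (ν.length + 1), ∑ η : Fin k → Fin (m + 1),
        c (List.ofFn η) * (List.ofFn η).foldr L oneSeries ν) (C K * G) := by
  intro ν hν
  have hterm : ∀ (k : ℕ) (η : Fin k → Fin (m + 1)),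
      |c (List.ofFn η) * (List.ofFn η).foldr L oneSeries ν|
        ≤ (((m : ℝ) + 1) ^ k)⁻¹ * ((ν.length)! * (K * coeff ν.length (Y ^ k))) := by
    intro k η
    have h1 := hc (List.ofFn η)
    have h2 := hL.dominatedBelow_foldr (by positivity) hG (List.ofFn η) ν hν
    rw [List.length_ofFn] at h1 h2
    rw [abs_mul]
    refine (mul_le_mul h1 h2 (abs_nonneg _) (by positivity)).trans_eq ?_
    rw [coeff_C_mul, mul_pow]
    field_simp
  calc |∑ k ∈ Finset.range (ν.length + 1), ∑ η : Fin k → Fin (m + 1),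
        c (List.ofFn η) * (List.ofFn η).foldr L oneSeries ν|
      ≤ ∑ k ∈ Finset.range (ν.length + 1), ∑ η : Fin k → Fin (m + 1),
        |c (List.ofFn η) * (List.ofFn η).foldr L oneSeries ν| :=
        (Finset.abs_sum_le_sum_abs _ _).trans
          (Finset.sum_le_sum fun k _ => Finset.abs_sum_le_sum_abs _ _)
    _ ≤ ∑ k ∈ Finset.range (ν.length + 1), (ν.length)! * (K * coeff ν.length (Y ^ k)) := by
        refine Finset.sum_le_sum fun k _ => ?_
        refine (Finset.sum_le_sum fun η _ => hterm k η).trans_eq ?_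
        rw [Finset.sum_const, Finset.card_univ, Fintype.card_fun, Fintype.card_fin,
          Fintype.card_fin, nsmul_eq_mul]
        push_cast
        field_simp
    _ ≤ (ν.length)! * coeff ν.length (C K * G) := by
        rw [← Finset.mul_sum, ← Finset.mul_sum, coeff_C_mul]
        gcongr
        exact hG.sum_coeff_pow_le _ _

end IsIntegralLike

/-- if `c` and `d` are locally convergent, then so is the
feedback product `c @ d`, the unique series satisfying
`c @ d = c ∘̃ (d ∘ (c @ d))`. -/
theorem feedbackProduct_locallyConvergent (m : ℕ) (c d w : SeriesVec m m)
    (hc : IsLocallyConvergent c) (hd : IsLocallyConvergent d)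
    (hw : w = modCompVec c (compVec d w)) :
    IsLocallyConvergent w := by
  obtain ⟨Kc, Mc, hKc, hMc, hc⟩ := hc
  obtain ⟨Kd, Md, hKd, hMd, hd⟩ := hd
  set K := max Kc Kd
  set M := max Mc Md
  have hK : 0 < K := lt_max_of_lt_left hKc
  have hM : 0 < M := lt_max_of_lt_left hMc
  have hcK : ∀ i (η : Word m), |c i η| ≤ K * M ^ η.length * (η.length)! := fun i η =>
    (hc η i).trans (by gcongr <;> exact le_max_left _ _)
  have hdK : ∀ i (η : Word m), |d i η| ≤ K * M ^ η.length * (η.length)! := fun i η =>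
    (hd η i).trans (by gcongr <;> exact le_max_right _ _)
  have hl : 0 < (1 + K) * (M * (m + 1)) := by positivity
  obtain ⟨Y, G, hG⟩ := exists_isMajorantPair hl
  have hdom : ∀ N i, DominatedBelow N (w i) (C K * G) := by
    intro N
    induction N with
    | zero => exact fun i ν hν => absurd hν ν.length.not_lt_zero
    | succ N ih =>
      have hcomp : ∀ i, DominatedBelow (N + 1) (compVec d w i) (C K * G) := by
        intro i
        have := (isIntegralLike_psiLetter hG hK.le ih).dominatedBelow_sum hK.le hM hG (hdK i)
        simp only [← psi_eq_foldr] at this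
        exact this
      intro i
      have := (isIntegralLike_phiLetter hG hK.le hcomp).dominatedBelow_sum hK.le hM hG (hcK i)
      simp only [← phi_eq_foldr] at this
      rw [hw]
      exact this.mono (N + 1).le_succ
  refine ⟨K, 2 * ((1 + K) * (M * (m + 1))), hK, by positivity, fun η i => ?_⟩
  refine (hdom (η.length + 1) i η η.length.lt_succ_self).trans ?_
  rw [coeff_C_mul, mul_comm]
  gcongr
  exact hG.coeff_right_le _
end

section
/- Let A ∈ ℝ^{n×n}, B ∈ ℝ^{n×m}, C ∈ ℝ^{m×n}, and let c ∈ ℝ^m⟨⟨X⟩⟩ be the linear generating series with coefficients (c_i, x_0^k x_j) = C_i A^k B_j for all k ≥ 0 and i, j ∈ {1, …, m} (where C_i is the i-th row of C and B_j the j-th column of B), and (c_i, η) = 0 for every word η not of the form x_0^k x_j. Then the composition inverse c^{-1} (the unique series with c^{-1} = (−c) ∘̃ c^{-1}) has coefficients (c_i^{-1}, x_0^k x_j) = −C_i (A − BC)^k B_j for all k ≥ 0 and i, j ∈ {1, …, m}, with all other coefficients zero. -/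
open scoped BigOperators

theorem zero_shuffle {m : ℕ} (e : Series m) (w : Word m) : shuffle 0 e w = 0 := by
  induction w generalizing e with
  | nil => simp [shuffle]
  | cons i w ih =>
    change shuffle 0 e w + shuffle 0 (fun w => e (i :: w)) w = 0
    rw [ih, ih, add_zero]

theorem shuffle_zero {m : ℕ} (d : Series m) (w : Word m) : shuffle d 0 w = 0 := by
  induction w generalizing d with
  | nil => simp [shuffle]
  | cons i w ih =>
    change shuffle (fun w => d (i :: w)) 0 w + shuffle d 0 w = 0
    rw [ih, ih, add_zero]

theorem shuffle_oneSeries {m : ℕ} (d : Series m) (w : Word m) :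
    shuffle d oneSeries w = d w := by
  induction w generalizing d with
  | nil => simp [shuffle, oneSeries]
  | cons i w ih =>
    have h : (fun w : Word m => (oneSeries (i :: w) : ℝ)) = 0 := by
      funext w
      simp [oneSeries]
    rw [shuffle, h, shuffle_zero, ih, add_zero]

theorem modComp_nil {m : ℕ} (c : Series m) (d : Fin m → Series m) :
    modComp c d [] = c [] := by
  simp [modComp, phi, oneSeries]

theorem modComp_smul_oneSeries {m : ℕ} (a : ℝ) (d : Fin m → Series m) (w : Word m) :
    modComp (a • oneSeries) d w = a * oneSeries w := by
  rw [modComp, Finset.sum_range_succ', Finset.sum_eq_zero]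
  · simp [phi, oneSeries]
  · intro k _
    refine Finset.sum_eq_zero fun η _ => ?_
    simp [oneSeries]

/-- If the words of `c` beginning with `x_j`, `j ≥ 1`, are just the letters `x_j`, then
`c ∘̃ d` obeys a first-letter recursion without shuffle products. -/
theorem modComp_cons {m : ℕ} (c : Series m) (d : Fin m → Series m) (b : Fin m → ℝ)
    (hnil : c [] = 0) (hc : ∀ j, leftQuot j.succ c = b j • oneSeries)
    (i : Fin (m + 1)) (w : Word m) :
    modComp c d (i :: w) =
      modComp (leftQuot i c) d w + if i = 0 then ∑ j, b j * d j w else 0 := by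
  have hshuffle : ∀ k, ∑ ℓ : Fin (m + 1), ∑ η : Fin k → Fin (m + 1),
      c (ℓ :: List.ofFn η) * shuffle (dhat d ℓ) (phi d (List.ofFn η) oneSeries) w =
      if k = 0 then ∑ j, b j * d j w else 0 := by
    intro k
    have hc' : ∀ j η, c (Fin.succ j :: η) = b j * oneSeries η := fun j η => congrFun (hc j) η
    rw [Fin.sum_univ_succ]
    simp only [dhat, Fin.cases_zero, Fin.cases_succ, zero_shuffle, mul_zero,
      Finset.sum_const_zero, zero_add, hc']
    rcases k with _ | k
    · simp [phi, shuffle_oneSeries, oneSeries]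
    · simp [oneSeries]
  have hstep : ∀ k, ∑ η : Fin (k + 1) → Fin (m + 1),
      c (List.ofFn η) * phi d (List.ofFn η) oneSeries (i :: w) =
      (∑ η : Fin k → Fin (m + 1),
        leftQuot i c (List.ofFn η) * phi d (List.ofFn η) oneSeries w) +
      if i = 0 then (if k = 0 then ∑ j, b j * d j w else 0) else 0 := by
    intro k
    have hofFn : ∀ (ℓ : Fin (m + 1)) (η : Fin k → Fin (m + 1)),
        List.ofFn (Fin.consEquiv (fun _ => Fin (m + 1)) (ℓ, η)) = ℓ :: List.ofFn η :=
      fun ℓ η => List.ofFn_cons ℓ η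
    rw [← (Fin.consEquiv fun _ => Fin (m + 1)).sum_comp, Fintype.sum_prod_type, ← hshuffle k]
    simp only [hofFn, phi, phiLetter, Pi.add_apply, prepend,
      mul_add, Finset.sum_add_distrib, leftQuot]
    congr 1
    · rw [Finset.sum_eq_single i]
      · simp
      · intro ℓ _ hℓ
        simp [hℓ.symm]
      · simp
    · split_ifs <;> simp
  rw [modComp, Finset.sum_range_succ']
  simp only [List.length_cons, hstep, Finset.sum_add_distrib]
  rw [modComp]
  by_cases hi : i = 0 <;> simp [hi, hnil]

/-- The linear series with coefficients `(x_0^k x_j) ↦ (v A^k B)_j`. -/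
noncomputable def linSeries {n m : ℕ} (A : Matrix (Fin n) (Fin n) ℝ)
    (B : Matrix (Fin n) (Fin m) ℝ) : (Fin n → ℝ) → Series m
  | _, [] => 0
  | v, i :: w => Fin.cases (motive := fun _ => ℝ) (linSeries A B (Matrix.vecMul v A) w)
      (fun j => Matrix.vecMul v B j * oneSeries w) i

section linSeries

variable {n m : ℕ} (A : Matrix (Fin n) (Fin n) ℝ) (B : Matrix (Fin n) (Fin m) ℝ)

theorem linSeries_zero_cons (v : Fin n → ℝ) (w : Word m) :
    linSeries A B v (0 :: w) = linSeries A B (Matrix.vecMul v A) w := rfl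

theorem linSeries_succ_cons (v : Fin n → ℝ) (j : Fin m) (w : Word m) :
    linSeries A B v (j.succ :: w) = Matrix.vecMul v B j * oneSeries w := rfl

theorem linSeries_add (u v : Fin n → ℝ) (w : Word m) :
    linSeries A B (u + v) w = linSeries A B u w + linSeries A B v w := by
  induction w generalizing u v with
  | nil => simp [linSeries]
  | cons i w ih =>
    cases i using Fin.cases with
    | zero => simp only [linSeries_zero_cons, Matrix.add_vecMul, ih]
    | succ j => simp only [linSeries_succ_cons, Matrix.add_vecMul, Pi.add_apply, add_mul]

theorem linSeries_smul (a : ℝ) (v : Fin n → ℝ) (w : Word m) :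
    linSeries A B (a • v) w = a * linSeries A B v w := by
  induction w generalizing v with
  | nil => simp [linSeries]
  | cons i w ih =>
    cases i using Fin.cases with
    | zero => simp only [linSeries_zero_cons, Matrix.smul_vecMul, ih]
    | succ j =>
      simp only [linSeries_succ_cons, Matrix.smul_vecMul, Pi.smul_apply, smul_eq_mul, mul_assoc]

theorem linSeries_sum {ι : Type*} (s : Finset ι) (a : ι → ℝ) (v : ι → Fin n → ℝ) (w : Word m) :
    linSeries A B (∑ j ∈ s, a j • v j) w = ∑ j ∈ s, a j * linSeries A B (v j) w := by
  classical
  induction s using Finset.induction_on with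
  | empty => simpa using linSeries_smul A B 0 0 w
  | insert j s hj ih =>
    rw [Finset.sum_insert hj, Finset.sum_insert hj, linSeries_add, linSeries_smul, ih]

theorem linSeries_replicate (v : Fin n → ℝ) (k : ℕ) (j : Fin m) :
    linSeries A B v (List.replicate k 0 ++ [j.succ]) = Matrix.vecMul v (A ^ k * B) j := by
  induction k generalizing v with
  | zero => simp [linSeries_succ_cons, oneSeries]
  | succ k ih =>
    rw [List.replicate_succ, List.cons_append, linSeries_zero_cons, ih, Matrix.vecMul_vecMul,
      pow_succ', Matrix.mul_assoc]

theorem linSeries_eq_zero (v : Fin n → ℝ) (w : Word m)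
    (hw : ¬ ∃ (k : ℕ) (j : Fin m), w = List.replicate k 0 ++ [j.succ]) :
    linSeries A B v w = 0 := by
  induction w generalizing v with
  | nil => rfl
  | cons i w ih =>
    cases i using Fin.cases with
    | zero =>
      refine ih _ ?_
      rintro ⟨k, j, rfl⟩
      exact hw ⟨k + 1, j, rfl⟩
    | succ j =>
      have : w ≠ [] := by
        rintro rfl
        exact hw ⟨0, j, rfl⟩
      simp [linSeries_succ_cons, oneSeries, this]

theorem leftQuot_zero_linSeries (v : Fin n → ℝ) :
    leftQuot 0 (linSeries A B v) = linSeries A B (Matrix.vecMul v A) := rfl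

theorem leftQuot_succ_linSeries (v : Fin n → ℝ) (j : Fin m) :
    leftQuot j.succ (linSeries A B v) = Matrix.vecMul v B j • oneSeries := rfl

/-- Output feedback `d_j = (-C_j) ∘̃ d` turns the state matrix `A` into `A - B C`. -/
theorem modComp_linSeries (C : Matrix (Fin m) (Fin n) ℝ) (d : Fin m → Series m)
    (hd : ∀ j, d j = modComp (linSeries A B (-C j)) d) (v : Fin n → ℝ) (w : Word m) :
    modComp (linSeries A B v) d w = linSeries (A - B * C) B v w := by
  induction w generalizing v with
  | nil => exact modComp_nil _ _
  | cons i w ih =>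
    rw [modComp_cons _ d (Matrix.vecMul v B) rfl (leftQuot_succ_linSeries A B v)]
    cases i using Fin.cases with
    | zero =>
      have hdw : ∀ j, d j w = linSeries (A - B * C) B (-C j) w := fun j => by
        rw [hd, ih]
      have hv : Matrix.vecMul v (A - B * C) =
          Matrix.vecMul v A + ∑ j, Matrix.vecMul v B j • -C j := by
        rw [Matrix.vecMul_sub, ← Matrix.vecMul_vecMul, Matrix.vecMul_eq_sum (Matrix.vecMul v B),
          sub_eq_add_neg, ← Finset.sum_neg_distrib]
        simp only [smul_neg]
      simp only [if_true, leftQuot_zero_linSeries, ih, hdw]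
      rw [linSeries_zero_cons, hv, linSeries_add, linSeries_sum]
    | succ j =>
      rw [leftQuot_succ_linSeries, modComp_smul_oneSeries, linSeries_succ_cons,
        if_neg (Fin.succ_ne_zero j), add_zero]

end linSeries

/-- for the linear generating series `c` with
`(c_i, x_0^k x_j) = C_i A^k B_j` and all other coefficients zero, the
composition inverse `c⁻¹` (the unique series with `c⁻¹ = (−c) ∘̃ c⁻¹`) has
coefficients `(c_i⁻¹, x_0^k x_j) = −C_i (A − BC)^k B_j`, with all other
coefficients zero. -/
theorem linear_series_inverse (n m : ℕ)
    (A : Matrix (Fin n) (Fin n) ℝ) (B : Matrix (Fin n) (Fin m) ℝ)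
    (C : Matrix (Fin m) (Fin n) ℝ) (c cinv : SeriesVec m m)
    (hc1 : ∀ (i j : Fin m) (k : ℕ),
      c i (List.replicate k (0 : Fin (m+1)) ++ [j.succ]) = (C * A ^ k * B) i j)
    (hc2 : ∀ (i : Fin m) (η : Word m),
      (¬ ∃ (k : ℕ) (j : Fin m), η = List.replicate k (0 : Fin (m+1)) ++ [j.succ]) → c i η = 0)
    (hinv : cinv = modCompVec (-c) cinv) :
    (∀ (i j : Fin m) (k : ℕ),
      cinv i (List.replicate k (0 : Fin (m+1)) ++ [j.succ]) = -((C * (A - B * C) ^ k * B) i j)) ∧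
    (∀ (i : Fin m) (η : Word m),
      (¬ ∃ (k : ℕ) (j : Fin m), η = List.replicate k (0 : Fin (m+1)) ++ [j.succ]) →
        cinv i η = 0) := by
  have hneg : ∀ i, (-c) i = linSeries A B (-C i) := by
    intro i
    funext w
    by_cases hw : ∃ (k : ℕ) (j : Fin m), w = List.replicate k 0 ++ [j.succ]
    · obtain ⟨k, j, rfl⟩ := hw
      rw [linSeries_replicate, Pi.neg_apply, Pi.neg_apply, hc1, Matrix.neg_vecMul,
        Matrix.mul_assoc]
      rfl
    · rw [linSeries_eq_zero A B _ w hw, Pi.neg_apply, Pi.neg_apply, hc2 i w hw, neg_zero]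
  have hfix : ∀ i, cinv i = modComp (linSeries A B (-C i)) cinv := fun i => by
    rw [← hneg]
    exact congrFun hinv i
  have hcinv : ∀ i w, cinv i w = linSeries (A - B * C) B (-C i) w := fun i w => by
    rw [hfix, modComp_linSeries A B C cinv hfix]
  refine ⟨fun i j k => ?_, fun i w hw => ?_⟩
  · rw [hcinv, linSeries_replicate, Matrix.neg_vecMul, Matrix.mul_assoc]
    rfl
  · rw [hcinv, linSeries_eq_zero _ _ _ w hw]
end
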